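/- arXiv:2111.06820 — 2 statements merged into one kernel-verified Lean document; each statement's English description precedes it below -/
import Mathlib

section
/- Let an instance of the block-angular min-max resource sharing problem with a σ-approximate block solver be given with m ≥ 2 and λ* ∈ [c, 1] for some constant c > 0. Let δ ∈ (0,1], set ε := δ/(8σ) and T := ⌈(log m)/(2 σ c ε²)⌉. Then in any run of the core algorithm with parameters ε and T, the average solution x^{(T)} := (1/T) ∑_{t=1}^{T} s^{(t)} ∈ 𝒳 (where s^{(t)} := ∑_{j : p_j = t} ξ_j b^{(j)}) and the average dual solution z^{(T)} := (1/T) ∑_{t=1}^{T} y^{(t)}/‖y^{(t)}‖_1 ∈ Δ_m satisfy: ‖x^{(T)}‖_∞ ≤ (1+δ) σ λ*; inf_{x∈𝒳} ⟨z^{(T)}, x⟩ ≥ (1−δ) λ*/σ; and for every nonempty S ⊆ ℛ and μ > 0 such that the instance satisfies local weak duality with respect to S and μ, max_{r∈S} x^{(T)}_r ≤ μ + δ · max{λ*, μ}. -/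
open scoped BigOperators

theorem aux_rec (T : ℕ) (Y D : ℕ → ℝ) (a B : ℝ) (ha : 0 ≤ a) (hY : ∀ t, 0 < Y t)
    (hD0 : ∀ t, 0 ≤ D t) (hDB : ∀ t, D t ≤ B) (haB : a * B < 1)
    (h : ∀ t, t < T → Y (t + 1) ≤ Y t + a * (D (t + 1) * Y (t + 1))) :
    Y T ≤ Y 0 * Real.exp (a / (1 - a * B) * ∑ t ∈ Finset.Icc 1 T, D t) := by
  have key : ∀ n, n ≤ T →
      Y n ≤ Y 0 * Real.exp (a / (1 - a * B) * ∑ t ∈ Finset.Icc 1 n, D t) := by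
    intro n
    induction n with
    | zero => intro _; simp
    | succ n ih =>
      intro hn
      have ih' := ih (by omega)
      rw [Finset.sum_Icc_succ_top (by omega), mul_add, Real.exp_add, ← mul_assoc]
      have h1 := h n (by omega)
      have hle : a * D (n + 1) ≤ a * B := mul_le_mul_of_nonneg_left (hDB _) ha
      have hpos : 0 < 1 - a * D (n + 1) := by linarith
      have hposB : 0 < 1 - a * B := by linarith
      have hx0 : 0 ≤ a * D (n + 1) := mul_nonneg ha (hD0 _)
      have h2 : Y (n + 1) * (1 - a * D (n + 1)) ≤ Y n := by linarith
      have h3 : 1 ≤ (1 - a * D (n + 1)) * Real.exp (a / (1 - a * B) * D (n + 1)) := by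
        have e1 := Real.add_one_le_exp (a / (1 - a * B) * D (n + 1))
        have e2 : a * D (n + 1) / (1 - a * D (n + 1)) ≤ a / (1 - a * B) * D (n + 1) := by
          rw [div_mul_eq_mul_div]
          gcongr
        calc (1 : ℝ) = (1 - a * D (n + 1)) * (a * D (n + 1) / (1 - a * D (n + 1)) + 1) := by
              field_simp; ring
          _ ≤ _ := by
              apply mul_le_mul_of_nonneg_left _ hpos.le
              linarith
      calc Y (n + 1) = Y (n + 1) * 1 := by ring
        _ ≤ Y (n + 1) * ((1 - a * D (n + 1)) * Real.exp (a / (1 - a * B) * D (n + 1))) :=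
            mul_le_mul_of_nonneg_left h3 (hY _).le
        _ = Y (n + 1) * (1 - a * D (n + 1)) * Real.exp (a / (1 - a * B) * D (n + 1)) := by ring
        _ ≤ Y n * Real.exp (a / (1 - a * B) * D (n + 1)) := by gcongr
        _ ≤ _ := by gcongr
  exact key T le_rfl

theorem aux_exp (ε u : ℝ) (hu0 : 0 ≤ u) (hu1 : u ≤ 1) :
    Real.exp (ε * u) ≤ 1 + (Real.exp ε - 1) * u := by
  have := convexOn_exp.2 (Set.mem_univ 0) (Set.mem_univ ε) (by linarith : 0 ≤ 1 - u) hu0 (by ring)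
  simp only [smul_eq_mul, mul_zero, zero_add, Real.exp_zero, mul_one] at this
  rw [mul_comm ε u]
  linarith

theorem aux_lower (N : ℕ) (p : Fin N → ℕ) (hpmono : ∀ j k : Fin N, j ≤ k → p j ≤ p k) (t : ℕ)
    (j : Fin N) : p j ≤ t ↔ j.1 < (Finset.univ.filter (fun j : Fin N => p j ≤ t)).card := by
  constructor
  · intro h
    have : (Finset.Iic j) ⊆ Finset.univ.filter (fun j : Fin N => p j ≤ t) := by
      intro k hk
      simp only [Finset.mem_Iic] at hk
      simp only [Finset.mem_filter, Finset.mem_univ, true_and]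
      exact (hpmono _ _ hk).trans h
    have := Finset.card_le_card this
    rw [Fin.card_Iic] at this
    omega
  · intro h
    by_contra hc
    have : Finset.univ.filter (fun j : Fin N => p j ≤ t) ⊆ Finset.Iio j := by
      intro k hk
      simp only [Finset.mem_filter, Finset.mem_univ, true_and] at hk
      simp only [Finset.mem_Iio]
      by_contra hkj
      exact hc ((hpmono _ _ (not_lt.mp hkj)).trans hk)
    have := Finset.card_le_card this
    rw [Fin.card_Iio] at this
    omega

theorem aux_tele (N : ℕ) (p : Fin N → ℕ) (hpmono : ∀ j k : Fin N, j ≤ k → p j ≤ p k)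
    (F : ℕ → ℝ) (t : ℕ) :
    F (Finset.univ.filter (fun j : Fin N => p j ≤ t)).card - F 0
      = ∑ j ∈ Finset.univ.filter (fun j : Fin N => p j ≤ t), (F (j.1 + 1) - F j.1) := by
  have hl := aux_lower N p hpmono t
  have hKN : (Finset.univ.filter (fun j : Fin N => p j ≤ t)).card ≤ N := by
    simpa using Finset.card_filter_le (Finset.univ : Finset (Fin N)) (fun j => p j ≤ t)
  rw [← Finset.sum_range_sub]
  generalize hK : (Finset.univ.filter (fun j : Fin N => p j ≤ t)).card = K at *
  rw [Finset.sum_filter]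
  simp_rw [hl]
  rw [Fin.sum_univ_eq_sum_range (fun k => if k < K then F (k + 1) - F k else 0) N,
    ← Finset.sum_filter]
  apply Finset.sum_congr _ (fun _ _ => rfl)
  ext k
  simp only [Finset.mem_range, Finset.mem_filter]
  omega

theorem aux_phase (N : ℕ) (p : Fin N → ℕ) (hpmono : ∀ j k : Fin N, j ≤ k → p j ≤ p k)
    (F : ℕ → ℝ) (t : ℕ) :
    F (Finset.univ.filter (fun j : Fin N => p j ≤ t + 1)).card
      = F (Finset.univ.filter (fun j : Fin N => p j ≤ t)).card
      + ∑ j ∈ Finset.univ.filter (fun j : Fin N => p j = t + 1), (F (j.1 + 1) - F j.1) := by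
  have h1 := aux_tele N p hpmono F t
  have h2 := aux_tele N p hpmono F (t + 1)
  have h3 : Finset.univ.filter (fun j : Fin N => p j ≤ t + 1)
      = Finset.univ.filter (fun j : Fin N => p j ≤ t)
        ∪ Finset.univ.filter (fun j : Fin N => p j = t + 1) := by
    ext j
    simp only [Finset.mem_filter, Finset.mem_univ, true_and, Finset.mem_union]
    omega
  have h4 : Disjoint (Finset.univ.filter (fun j : Fin N => p j ≤ t))
        (Finset.univ.filter (fun j : Fin N => p j = t + 1)) := by
    rw [Finset.disjoint_filter]
    intro j _ h
    omega
  have h5 := Finset.sum_union h4 (f := fun j : Fin N => F (j.1 + 1) - F j.1)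
  rw [← h3] at h5
  linarith

set_option maxHeartbeats 4000000 in
/-- (Main theorem on normalized instances.)  If `λ* ∈ [c,1]`, `δ ∈ (0,1]`,
`ε := δ/(8σ)` and `T := ⌈(log m)/(2σcε²)⌉`, then in any run of the core algorithm the
average solution `x^{(T)} ∈ 𝒳` and the average dual solution `z^{(T)} ∈ Δ_m` satisfy
`‖x^{(T)}‖_∞ ≤ (1+δ)σλ*`, `inf_{x∈𝒳}⟨z^{(T)},x⟩ ≥ (1−δ)λ*/σ`, and
`max_{r∈S} x^{(T)}_r ≤ μ + δ max{λ*,μ}` whenever local weak duality holds w.r.t. `S, μ`. -/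
theorem stmt_9 (m : ℕ) (hm : 2 ≤ m)
    (𝒞 : Type) [Fintype 𝒞] [Nonempty 𝒞] [DecidableEq 𝒞]
    (X : 𝒞 → Set (Fin m → ℝ))
    (hXne : ∀ c, (X c).Nonempty) (hXcl : ∀ c, IsClosed (X c))
    (hXcv : ∀ c, Convex ℝ (X c))
    (hXpos : ∀ c, ∀ x ∈ X c, ∀ r, 0 ≤ x r)
    (𝒳 : Set (Fin m → ℝ))
    (h𝒳 : 𝒳 = {x | ∃ g : 𝒞 → Fin m → ℝ, (∀ c, g c ∈ X c) ∧ x = ∑ c, g c})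
    (lam : ℝ) (hlam : lam = ⨅ x : 𝒳, ‖(x : Fin m → ℝ)‖)
    (c₀ : ℝ) (hc₀ : 0 < c₀) (hlam_lb : c₀ ≤ lam) (hlam_ub : lam ≤ 1)
    (σ : ℝ) (hσ : 1 ≤ σ)
    (f : 𝒞 → (Fin m → ℝ) → (Fin m → ℝ))
    (hfmem : ∀ c y, (∀ r, 0 ≤ y r) → f c y ∈ X c)
    (hfapx : ∀ c y, (∀ r, 0 ≤ y r) →
      ∑ r, y r * f c y r ≤ σ * ⨅ x : X c, ∑ r, y r * (x : Fin m → ℝ) r)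
    (δ : ℝ) (hδ0 : 0 < δ) (hδ1 : δ ≤ 1)
    (ε : ℝ) (hεdef : ε = δ / (8 * σ))
    (T : ℕ) (hTdef : T = ⌈Real.log m / (2 * σ * c₀ * ε ^ 2)⌉₊)
    -- a run of the core algorithm with parameters ε and T
    (N : ℕ) (p : Fin N → ℕ) (Cu : Fin N → 𝒞) (ξ : Fin N → ℝ)
    (hp : ∀ j, 1 ≤ p j ∧ p j ≤ T)
    (hpmono : ∀ j k : Fin N, j ≤ k → p j ≤ p k)
    (hξ0 : ∀ j, 0 ≤ ξ j)
    (w : ℕ → Fin m → ℝ) (hw0 : w 0 = fun _ => 1)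
    (b : Fin N → Fin m → ℝ) (hb : ∀ j, b j = f (Cu j) (w j.1))
    (hwsucc : ∀ j : Fin N, w (j.1 + 1) = fun r => w j.1 r * Real.exp (ε * ξ j * b j r))
    (hstep : ∀ j, ξ j * ‖b j‖ ≤ 1)
    (hphase : ∀ t, 1 ≤ t → t ≤ T → ∀ c,
      ∑ j ∈ Finset.univ.filter (fun j => p j = t ∧ Cu j = c), ξ j = 1)
    (y : ℕ → Fin m → ℝ)
    (hy : ∀ t, y t = w (Finset.univ.filter (fun j : Fin N => p j ≤ t)).card)
    -- the final average primal and dual solutions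
    (s : ℕ → Fin m → ℝ)
    (hs : ∀ t, s t = ∑ j ∈ Finset.univ.filter (fun j : Fin N => p j = t), ξ j • b j)
    (xT : Fin m → ℝ) (hxT : xT = (T : ℝ)⁻¹ • ∑ q ∈ Finset.Icc 1 T, s q)
    (zT : Fin m → ℝ) (hzT : zT = (T : ℝ)⁻¹ • ∑ q ∈ Finset.Icc 1 T, (∑ r, |y q r|)⁻¹ • y q) :
    xT ∈ 𝒳 ∧
    (∀ r, 0 ≤ zT r ∧ zT r ≤ 1) ∧ (∑ r, zT r = 1) ∧
    ‖xT‖ ≤ (1 + δ) * σ * lam ∧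
    (1 - δ) * lam / σ ≤ (⨅ x : 𝒳, ∑ r, zT r * (x : Fin m → ℝ) r) ∧
    (∀ (S : Finset (Fin m)), S.Nonempty → ∀ μ : ℝ, 0 < μ →
      (∀ yy : 𝒞 → Fin m → ℝ, (∀ c r, 0 ≤ yy c r) →
        ∑ c, ∑ r ∈ S, yy c r * f c (yy c) r ≤ μ * ∑ r ∈ S, ⨆ c, yy c r) →
      ∀ r ∈ S, xT r ≤ μ + δ * max lam μ) := by
  classical
  have hσ0 : 0 < σ := by linarith
  have hε0 : 0 < ε := by rw [hεdef]; positivity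
  have hεσ : ε * σ = δ / 8 := by rw [hεdef]; field_simp
  have hεδ : ε ≤ δ / 8 := by nlinarith
  have hlam0 : 0 < lam := by linarith
  have hlogm : 0 < Real.log m := Real.log_pos (by exact_mod_cast hm)
  have hTge : Real.log m / (2 * σ * c₀ * ε ^ 2) ≤ T := by rw [hTdef]; exact Nat.le_ceil _
  have hT0 : (0 : ℝ) < T := lt_of_lt_of_le (by positivity) hTge
  have hlogT : Real.log m ≤ ε * T * (δ * lam / 4) := by
    rw [div_le_iff₀ (by positivity)] at hTge
    calc Real.log m ≤ T * (2 * σ * c₀ * ε ^ 2) := hTge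
      _ = ε * T * (2 * (ε * σ)) * c₀ := by ring
      _ ≤ ε * T * (2 * (ε * σ)) * lam := by gcongr
      _ = _ := by rw [hεσ]; ring
  -- the effective rate
  obtain ⟨e, he⟩ : ∃ e, e = Real.exp ε - 1 := ⟨_, rfl⟩
  have he0 : 0 < e := by have := Real.add_one_le_exp ε; linarith
  have he1 : e ≤ ε * (1 + δ / 8) := by
    have h1 := Real.abs_exp_sub_one_sub_id_le (x := ε) (by rw [abs_of_pos hε0]; linarith)
    have := le_of_abs_le h1
    nlinarith
  -- positivity
  obtain ⟨K, hK⟩ : ∃ K : ℕ → ℕ, ∀ t, K t = (Finset.univ.filter (fun j : Fin N => p j ≤ t)).card :=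
    ⟨_, fun _ => rfl⟩
  have hKN : ∀ t, K t ≤ N := by
    intro t
    rw [hK]
    simpa using Finset.card_filter_le (Finset.univ : Finset (Fin N)) (fun j => p j ≤ t)
  have hyK : ∀ t, y t = w (K t) := by intro t; rw [hy, hK]
  have hwpos : ∀ k, k ≤ N → ∀ r, 0 < w k r := by
    intro k
    induction k with
    | zero => intro _ r; simp [hw0]
    | succ k ih =>
      intro hk r
      have := hwsucc ⟨k, by omega⟩
      simp only at this
      rw [this]
      exact mul_pos (ih (by omega) r) (Real.exp_pos _)
  have hwposj : ∀ j : Fin N, ∀ r, 0 < w j.1 r := fun j r => hwpos _ j.2.le r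
  have hypos : ∀ t r, 0 < y t r := by intro t r; rw [hyK]; exact hwpos _ (hKN t) r
  have hbmem : ∀ j, b j ∈ X (Cu j) := by
    intro j; rw [hb]; exact hfmem _ _ (fun r => (hwposj j r).le)
  have hb0 : ∀ j r, 0 ≤ b j r := fun j r => hXpos _ _ (hbmem j) r
  have hξb1 : ∀ j r, ξ j * b j r ≤ 1 := by
    intro j r
    refine le_trans (mul_le_mul_of_nonneg_left ?_ (hξ0 j)) (hstep j)
    exact (le_abs_self _).trans (norm_le_pi_norm (b j) r)
  have hwmono : ∀ k l, k ≤ l → l ≤ N → ∀ r, w k r ≤ w l r := by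
    intro k l hkl
    induction l, hkl using Nat.le_induction with
    | base => intro _ r; exact le_rfl
    | succ l hl ih =>
      intro hN r
      refine (ih (by omega) r).trans ?_
      have := hwsucc ⟨l, by omega⟩
      simp only at this
      rw [this]
      apply le_mul_of_one_le_right (hwpos l (by omega) r).le
      apply Real.one_le_exp
      exact mul_nonneg (mul_nonneg hε0.le (hξ0 _)) (hb0 _ _)
  have hwy : ∀ j : Fin N, ∀ r, w j.1 r ≤ y (p j) r := by
    intro j r
    rw [hyK]
    refine hwmono _ _ ?_ (hKN _) r
    rw [hK]
    exact ((aux_lower N p hpmono (p j) j).1 le_rfl).le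
  have hy0 : y 0 = fun _ => 1 := by
    rw [hy, Finset.filter_false_of_mem]
    · simpa using hw0
    · intro j _
      have := (hp j).1
      omega
  -- log of final prices
  have hxTsum : ∀ r, ∑ j, ξ j * b j r = T * xT r := by
    intro r
    rw [hxT]
    simp only [Pi.smul_apply, smul_eq_mul, Finset.sum_apply]
    rw [mul_inv_cancel_left₀ hT0.ne']
    have : ∀ q, s q r = ∑ j ∈ Finset.univ.filter (fun j : Fin N => p j = q), ξ j * b j r := by
      intro q; rw [hs]; simp
    simp_rw [this]
    rw [Finset.sum_fiberwise_of_maps_to]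
    intro j _
    exact Finset.mem_Icc.2 (hp j)
  have hyT : ∀ r, y T r = Real.exp (ε * T * xT r) := by
    intro r
    have h1 := aux_tele N p hpmono (fun k => Real.log (w k r)) T
    rw [← hK, Finset.filter_true_of_mem (fun j _ => (hp j).2)] at h1
    simp only [hw0, Real.log_one, sub_zero] at h1
    have h2 : ∀ j : Fin N, Real.log (w (j.1 + 1) r) - Real.log (w j.1 r) = ε * (ξ j * b j r) := by
      intro j
      rw [hwsucc]
      simp only
      rw [Real.log_mul (hwposj j r).ne' (Real.exp_pos _).ne', Real.log_exp]
      ring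
    simp_rw [h2] at h1
    rw [← Finset.mul_sum, hxTsum] at h1
    rw [mul_assoc, ← h1, ← hyK, Real.exp_log (hypos T r)]
  -- one phase
  have hphaseS : ∀ (S : Finset (Fin m)) (t : ℕ), ∑ r ∈ S, y (t + 1) r ≤ ∑ r ∈ S, y t r
      + e * ∑ j ∈ Finset.univ.filter (fun j : Fin N => p j = t + 1),
          ξ j * ∑ r ∈ S, w j.1 r * b j r := by
    intro S t
    have h1 := aux_phase N p hpmono (fun k => ∑ r ∈ S, w k r) t
    rw [← hK, ← hK] at h1
    simp only [← hyK] at h1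
    rw [h1, Finset.mul_sum]
    gcongr with j hj
    rw [← Finset.sum_sub_distrib, Finset.mul_sum, Finset.mul_sum]
    gcongr with r hr
    rw [hwsucc]
    simp only
    have h2 := aux_exp ε (ξ j * b j r) (mul_nonneg (hξ0 j) (hb0 j r)) (hξb1 j r)
    rw [← he, ← mul_assoc ε] at h2
    have := mul_le_mul_of_nonneg_left h2 (hwposj j r).le
    linarith
  have hfib : ∀ (t : ℕ) (h : Fin N → ℝ),
      ∑ j ∈ Finset.univ.filter (fun j : Fin N => p j = t), h j
      = ∑ c, ∑ j ∈ Finset.univ.filter (fun j : Fin N => p j = t ∧ Cu j = c), h j := by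
    intro t h
    rw [← Finset.sum_fiberwise _ Cu]
    simp_rw [Finset.filter_filter]
  -- membership
  have hxmem : xT ∈ 𝒳 := by
    rw [h𝒳]
    refine ⟨fun c => ∑ j ∈ Finset.univ.filter (fun j => Cu j = c), ((T : ℝ)⁻¹ * ξ j) • b j, ?_, ?_⟩
    · intro c
      apply (hXcv c).sum_mem
      · intro j _
        exact mul_nonneg (by positivity) (hξ0 j)
      · rw [← Finset.mul_sum]
        have h1 : ∑ j ∈ Finset.univ.filter (fun j => Cu j = c), ξ j = T := by
          rw [← Finset.sum_fiberwise_of_maps_to (t := Finset.Icc 1 T) (g := p)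
            (fun j _ => Finset.mem_Icc.2 (hp j))]
          have : ∀ t ∈ Finset.Icc 1 T,
              ∑ j ∈ (Finset.univ.filter (fun j => Cu j = c)).filter (fun j => p j = t), ξ j
                = 1 := by
            intro t ht
            rw [Finset.mem_Icc] at ht
            rw [Finset.filter_filter, ← hphase t ht.1 ht.2 c]
            simp_rw [and_comm]
          rw [Finset.sum_congr rfl this]
          simp
        rw [h1, inv_mul_cancel₀ hT0.ne']
      · intro j hj
        have := (Finset.mem_filter.1 hj).2
        rw [← this]
        exact hbmem j
    · rw [Finset.sum_fiberwise]
      ext r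
      have := hxTsum r
      simp only [Finset.sum_apply, Pi.smul_apply, smul_eq_mul]
      simp_rw [mul_assoc]
      rw [← Finset.mul_sum, this, inv_mul_cancel_left₀ hT0.ne']
  have hXX0 : ∀ x ∈ 𝒳, ∀ r, 0 ≤ x r := by
    intro x hx r
    rw [h𝒳] at hx
    obtain ⟨g, hg, rfl⟩ := hx
    rw [Finset.sum_apply]
    exact Finset.sum_nonneg (fun c _ => hXpos c _ (hg c) r)
  have : Nonempty 𝒳 := ⟨⟨xT, hxmem⟩⟩
  have hlamle : ∀ x ∈ 𝒳, lam ≤ ‖x‖ := by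
    intro x hx
    rw [hlam]
    exact ciInf_le (f := fun x : 𝒳 => ‖(x : Fin m → ℝ)‖)
      ⟨0, by rintro _ ⟨x, rfl⟩; exact norm_nonneg _⟩ ⟨x, hx⟩
  -- norms
  have : Nonempty (Fin m) := ⟨⟨0, by omega⟩⟩
  obtain ⟨Y, hY⟩ : ∃ Y : ℕ → ℝ, ∀ t, Y t = ∑ r, y t r := ⟨_, fun _ => rfl⟩
  have hYabs : ∀ t, ∑ r, |y t r| = Y t := by
    intro t
    rw [hY]
    exact Finset.sum_congr rfl (fun r _ => abs_of_pos (hypos t r))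
  have hYpos : ∀ t, 0 < Y t := by
    intro t; rw [hY]
    exact Finset.sum_pos (fun r _ => hypos t r) Finset.univ_nonempty
  have hzapp : ∀ r, zT r = (T : ℝ)⁻¹ * ∑ q ∈ Finset.Icc 1 T, (Y q)⁻¹ * y q r := by
    intro r
    rw [hzT]
    simp [hYabs]
  have hz0 : ∀ r, 0 ≤ zT r := by
    intro r
    rw [hzapp]
    exact mul_nonneg (by positivity) (Finset.sum_nonneg fun q _ =>
      mul_nonneg (inv_nonneg.2 (hYpos q).le) (hypos q r).le)
  have hzsum : ∑ r, zT r = 1 := by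
    simp_rw [hzapp]
    rw [← Finset.mul_sum, Finset.sum_comm]
    have : ∀ q ∈ Finset.Icc 1 T, ∑ r, (Y q)⁻¹ * y q r = 1 := by
      intro q _
      rw [← Finset.mul_sum, ← hY, inv_mul_cancel₀ (hYpos q).ne']
    rw [Finset.sum_congr rfl this]
    simp [hT0.ne']
  obtain ⟨O, hO⟩ : ∃ O : 𝒞 → (Fin m → ℝ) → ℝ, ∀ c v,
      O c v = ⨅ x : X c, ∑ r, v r * (x : Fin m → ℝ) r := ⟨_, fun _ _ => rfl⟩
  have hOle : ∀ c v, (∀ r, 0 ≤ v r) → ∀ x ∈ X c, O c v ≤ ∑ r, v r * x r := by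
    intro c v hv x hx
    rw [hO]
    exact ciInf_le (f := fun x : X c => ∑ r, v r * (x : Fin m → ℝ) r)
      ⟨0, by
        rintro _ ⟨x, rfl⟩
        exact Finset.sum_nonneg fun r _ => mul_nonneg (hv r) (hXpos c _ x.2 r)⟩ ⟨x, hx⟩
  have hO0 : ∀ c v, (∀ r, 0 ≤ v r) → 0 ≤ O c v := by
    intro c v hv
    have : Nonempty (X c) := (hXne c).to_subtype
    rw [hO]
    exact le_ciInf fun x =>
        Finset.sum_nonneg fun r _ => mul_nonneg (hv r) (hXpos c _ x.2 r)
  have hOmono : ∀ c v v', (∀ r, 0 ≤ v r) → (∀ r, v r ≤ v' r) → O c v ≤ O c v' := by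
    intro c v v' hv hvv
    have : Nonempty (X c) := (hXne c).to_subtype
    rw [hO c v']
    refine le_ciInf fun x => (hOle c v hv x x.2).trans ?_
    exact Finset.sum_le_sum fun r _ => mul_le_mul_of_nonneg_right (hvv r) (hXpos c _ x.2 r)
  obtain ⟨D, hD⟩ : ∃ D : ℕ → ℝ, ∀ t, D t = (∑ c, O c (y t)) / Y t := ⟨_, fun _ => rfl⟩
  have hD0 : ∀ t, 0 ≤ D t := by
    intro t
    rw [hD]
    exact div_nonneg (Finset.sum_nonneg fun c _ => hO0 c _ fun r => (hypos t r).le) (hYpos t).le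
  have hOX : ∀ t, ∀ x ∈ 𝒳, ∑ c, O c (y t) ≤ ∑ r, y t r * x r := by
    intro t x hx
    rw [h𝒳] at hx
    obtain ⟨g, hg, rfl⟩ := hx
    calc ∑ c, O c (y t) ≤ ∑ c, ∑ r, y t r * g c r :=
          Finset.sum_le_sum fun c _ => hOle c _ (fun r => (hypos t r).le) _ (hg c)
      _ = _ := by
          rw [Finset.sum_comm]
          simp [Finset.mul_sum]
  have hDlam : ∀ t, D t ≤ lam := by
    intro t
    rw [hlam]
    refine le_ciInf fun x => ?_
    rw [hD, div_le_iff₀ (hYpos t)]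
    refine (hOX t x x.2).trans ?_
    rw [hY, Finset.mul_sum]
    refine Finset.sum_le_sum fun r _ => ?_
    rw [mul_comm]
    refine mul_le_mul_of_nonneg_right ?_ (hypos t r).le
    exact (le_abs_self _).trans (norm_le_pi_norm (x : Fin m → ℝ) r)
  have hrec : ∀ t, t < T → Y (t + 1) ≤ Y t + e * σ * (D (t + 1) * Y (t + 1)) := by
    intro t ht
    have h1 := hphaseS Finset.univ t
    rw [← hY, ← hY] at h1
    refine h1.trans ?_
    rw [hD, div_mul_cancel₀ _ (hYpos _).ne', mul_assoc, hfib]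
    gcongr
    rw [Finset.mul_sum]
    refine Finset.sum_le_sum fun c _ => ?_
    calc _ ≤ ∑ j ∈ Finset.univ.filter (fun j : Fin N => p j = t + 1 ∧ Cu j = c),
          ξ j * (σ * O c (y (t + 1))) := by
          refine Finset.sum_le_sum fun j hj => ?_
          obtain ⟨hj1, hj2⟩ := (Finset.mem_filter.1 hj).2
          refine mul_le_mul_of_nonneg_left ?_ (hξ0 j)
          have h3 := hfapx (Cu j) (w j.1) (fun r => (hwposj j r).le)
          rw [← hb, ← hO] at h3
          refine h3.trans (mul_le_mul_of_nonneg_left ?_ hσ0.le)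
          rw [hj2, ← hj1]
          exact hOmono _ _ _ (fun r => (hwposj j r).le) (hwy j)
      _ = _ := by
          rw [← Finset.sum_mul, hphase (t + 1) (by omega) (by omega), one_mul]
  have heσ : e * σ ≤ 9 * δ / 64 := by
    have : e * σ ≤ ε * (1 + δ / 8) * σ := by gcongr
    nlinarith
  have heσl : e * σ * lam ≤ 9 * δ / 64 :=
    (mul_le_of_le_one_right (by positivity) hlam_ub).trans heσ
  have hmain := aux_rec T Y D (e * σ) lam (by positivity) hYpos hD0 hDlam (by linarith) hrec
  have hY0 : Y 0 = m := by rw [hY, hy0]; simp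
  obtain ⟨A, hA⟩ : ∃ A : ℝ, A = (T : ℝ)⁻¹ * ∑ t ∈ Finset.Icc 1 T, D t := ⟨_, rfl⟩
  have hA0 : 0 ≤ A := by
    rw [hA]; exact mul_nonneg (by positivity) (Finset.sum_nonneg fun t _ => hD0 t)
  have hTA : ∑ t ∈ Finset.Icc 1 T, D t = T * A := by
    rw [hA, mul_inv_cancel_left₀ hT0.ne']
  have hAlam : A ≤ lam := by
    have : ∑ t ∈ Finset.Icc 1 T, D t ≤ ∑ t ∈ Finset.Icc 1 T, lam :=
      Finset.sum_le_sum fun t _ => hDlam t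
    simp at this
    rw [hTA] at this
    exact le_of_mul_le_mul_left this hT0
  have hm0 : (0 : ℝ) < m := by exact_mod_cast (by omega : 0 < m)
  have hxbound : ∀ r, xT r ≤ δ * lam / 4 + (1 + 3 * δ / 8) * σ * A := by
    intro r
    have h1 : y T r ≤ Y T := by
      rw [hY]
      exact Finset.single_le_sum (fun r _ => (hypos T r).le) (Finset.mem_univ r)
    rw [hyT] at h1
    have h2 := h1.trans hmain
    rw [hY0, hTA] at h2
    nth_rewrite 1 [← Real.exp_log hm0] at h2
    rw [← Real.exp_add, Real.exp_le_exp] at h2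
    have hG : e * σ / (1 - e * σ * lam) ≤ ε * σ * (1 + 3 * δ / 8) := by
      rw [div_le_iff₀ (by linarith)]
      have a1 : e * σ ≤ ε * (1 + δ / 8) * σ := by gcongr
      have a2 : (1 + δ / 8) ≤ (1 + 3 * δ / 8) * (1 - e * σ * lam) := by nlinarith
      calc e * σ ≤ ε * σ * (1 + δ / 8) := by linarith
        _ ≤ ε * σ * ((1 + 3 * δ / 8) * (1 - e * σ * lam)) := by gcongr
        _ = _ := by ring
    have h3 : e * σ / (1 - e * σ * lam) * (T * A) ≤ ε * σ * (1 + 3 * δ / 8) * (T * A) := by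
      gcongr
    have h4 : ε * T * xT r ≤ ε * T * (δ * lam / 4 + (1 + 3 * δ / 8) * σ * A) := by
      linarith
    exact le_of_mul_le_mul_left h4 (by positivity)
  have hnorm : ‖xT‖ ≤ δ * lam / 4 + (1 + 3 * δ / 8) * σ * A := by
    rw [pi_norm_le_iff_of_nonneg (by positivity)]
    intro r
    rw [Real.norm_of_nonneg (hXX0 _ hxmem r)]
    exact hxbound r
  have hprimal : ‖xT‖ ≤ (1 + δ) * σ * lam := by
    refine hnorm.trans ?_
    have h1 : (1 + 3 * δ / 8) * σ * A ≤ (1 + 3 * δ / 8) * σ * lam := by gcongr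
    have h2 : δ * lam ≤ σ * (δ * lam) := le_mul_of_one_le_left (by positivity) hσ
    have h3 : 0 ≤ σ * (δ * lam) := by positivity
    linarith
  refine ⟨hxmem, fun r => ⟨hz0 r, ?_⟩, hzsum, hprimal, ?_, ?_⟩
  · rw [← hzsum]
    exact Finset.single_le_sum (fun r _ => hz0 r) (Finset.mem_univ r)
  · have h1 : (1 - δ) * lam / σ ≤ A := by
      rw [div_le_iff₀ hσ0]
      have h2 := (hlamle xT hxmem).trans hnorm
      have h3 : (1 - δ) * (1 + 3 * δ / 8) * lam ≤ (1 - δ / 4) * lam := by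
        gcongr
        nlinarith
      have h4 : (1 + 3 * δ / 8) * ((1 - δ) * lam) ≤ (1 + 3 * δ / 8) * (A * σ) := by
        linarith
      exact le_of_mul_le_mul_left h4 (by positivity)
    refine h1.trans (le_ciInf fun x => ?_)
    have h5 : ∑ r, zT r * (x : Fin m → ℝ) r
        = (T : ℝ)⁻¹ * ∑ q ∈ Finset.Icc 1 T, (Y q)⁻¹ * ∑ r, y q r * (x : Fin m → ℝ) r := by
      simp_rw [hzapp, Finset.mul_sum, Finset.sum_mul]
      rw [Finset.sum_comm]
      simp_rw [mul_assoc]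
    rw [h5, hA]
    gcongr with q hq
    rw [hD, div_eq_inv_mul]
    exact mul_le_mul_of_nonneg_left (hOX q x x.2) (inv_nonneg.2 (hYpos q).le)
  · intro S hS μ hμ hloc r hr
    have hmaxl := le_max_left lam μ
    have hmaxr := le_max_right lam μ
    by_cases hbig : 2 * σ ≤ μ
    · have h1 : xT r ≤ ‖xT‖ := (le_abs_self _).trans (norm_le_pi_norm xT r)
      have h2 : (1 + δ) * σ * lam ≤ 2 * σ * 1 := by gcongr; linarith
      have h3 : 0 ≤ δ * max lam μ := mul_nonneg hδ0.le (hlam0.le.trans hmaxl)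
      linarith
    · push Not at hbig
      have heμ : e * μ ≤ 9 * δ / 32 := by
        have : e * μ ≤ e * (2 * σ) := by gcongr
        linarith
      have hrecS : ∀ t, t < T → ∑ r ∈ S, y (t + 1) r
          ≤ ∑ r ∈ S, y t r + e * (μ * ∑ r ∈ S, y (t + 1) r) := by
        intro t ht
        refine (hphaseS S t).trans ?_
        rw [hfib]
        gcongr
        have hmx : ∀ c, ∃ j ∈ Finset.univ.filter (fun j : Fin N => p j = t + 1 ∧ Cu j = c),
            ∀ k ∈ Finset.univ.filter (fun j : Fin N => p j = t + 1 ∧ Cu j = c),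
              ∑ r ∈ S, w k.1 r * b k r ≤ ∑ r ∈ S, w j.1 r * b j r := by
          intro c
          apply Finset.exists_max_image _ (fun j : Fin N => ∑ r ∈ S, w j.1 r * b j r)
          by_contra hne
          rw [Finset.not_nonempty_iff_eq_empty] at hne
          have := hphase (t + 1) (by omega) (by omega) c
          rw [hne] at this
          simp at this
        choose jc hjc1 hjc2 using hmx
        have hjp : ∀ c, p (jc c) = t + 1 := fun c => (Finset.mem_filter.1 (hjc1 c)).2.1
        have hjC : ∀ c, Cu (jc c) = c := fun c => (Finset.mem_filter.1 (hjc1 c)).2.2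
        calc _ ≤ ∑ c, ∑ j ∈ Finset.univ.filter (fun j : Fin N => p j = t + 1 ∧ Cu j = c),
              ξ j * ∑ r ∈ S, w (jc c).1 r * b (jc c) r := by
              refine Finset.sum_le_sum fun c _ => Finset.sum_le_sum fun j hj => ?_
              exact mul_le_mul_of_nonneg_left (hjc2 c j hj) (hξ0 j)
          _ = ∑ c, ∑ r ∈ S, w (jc c).1 r * f c (w (jc c).1) r := by
              refine Finset.sum_congr rfl fun c _ => ?_
              rw [← Finset.sum_mul, hphase (t + 1) (by omega) (by omega), one_mul, hb, hjC]
          _ ≤ μ * ∑ r ∈ S, ⨆ c, w (jc c).1 r :=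
              hloc (fun c => w (jc c).1) (fun c r => (hwposj _ r).le)
          _ ≤ _ := by
              gcongr with r hr
              refine ciSup_le fun c => ?_
              rw [← hjp c]
              exact hwy _ r
      have h1 := aux_rec T (fun t => ∑ r ∈ S, y t r) (fun _ => μ) e μ he0.le
        (fun t => Finset.sum_pos (fun r _ => hypos t r) hS) (fun _ => hμ.le) (fun _ => le_rfl)
        (by linarith) hrecS
      simp only [hy0, Finset.sum_const, Nat.card_Icc, Nat.add_sub_cancel, nsmul_eq_mul, mul_one]
        at h1
      have h0 : y T r ≤ ∑ r ∈ S, y T r :=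
        Finset.single_le_sum (fun r _ => (hypos T r).le) hr
      have hcard : (S.card : ℝ) ≤ m := by
        exact_mod_cast (by simpa using Finset.card_le_univ S : S.card ≤ m)
      rw [hyT] at h0
      have h2 := (h0.trans h1).trans
        (mul_le_mul_of_nonneg_right hcard (Real.exp_pos _).le)
      nth_rewrite 1 [← Real.exp_log hm0] at h2
      rw [← Real.exp_add, Real.exp_le_exp] at h2
      have hG : e / (1 - e * μ) ≤ ε * (1 + 3 * δ / 4) := by
        rw [div_le_iff₀ (by linarith)]
        have a2 : (1 + δ / 8) ≤ (1 + 3 * δ / 4) * (1 - e * μ) := by nlinarith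
        calc e ≤ ε * (1 + δ / 8) := by linarith
          _ ≤ ε * ((1 + 3 * δ / 4) * (1 - e * μ)) := by gcongr
          _ = _ := by ring
      have h3 : e / (1 - e * μ) * (T * μ) ≤ ε * (1 + 3 * δ / 4) * (T * μ) := by
        gcongr
      have h4 : ε * T * xT r ≤ ε * T * (δ * lam / 4 + (1 + 3 * δ / 4) * μ) := by
        linarith
      have h5 := le_of_mul_le_mul_left h4 (by positivity)
      have h6 : δ * lam ≤ δ * max lam μ := by gcongr
      have h7 : δ * μ ≤ δ * max lam μ := by gcongr
      linarith
end

section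
/- Let an instance of the block-angular min-max resource sharing problem with an exact block solver (σ = 1) be given with m ≥ 2 and λ* = 1. Let δ ∈ (0,1], let 0 < ε < δ²/4, and let T ≥ (log m)/ε² be a positive integer. Then in any run of the core algorithm with parameters ε and T, there exists a phase T' ∈ {1,…,T} with T' ≥ (1−δ)T such that Θ_{T'} ≥ 1 − δ, where Θ_t := (∑_{C∈𝒞} inf_{x∈X_C} ⟨y^{(t)}, x⟩) / ‖y^{(t)}‖_1. -/
open scoped BigOperators


lemma aux_exp_s16 (x a : ℝ) (h0 : 0 ≤ a) (h1 : a ≤ 1) :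
    Real.exp (x * a) ≤ 1 - a + a * Real.exp x := by
  have h := convexOn_exp.2 (Set.mem_univ (0 : ℝ)) (Set.mem_univ x)
    (sub_nonneg.2 h1) h0 (by ring)
  simp only [smul_eq_mul, mul_zero, zero_add, Real.exp_zero, mul_one] at h
  rwa [mul_comm x a]

lemma aux_c (ε : ℝ) (h0 : 0 < ε) (h1 : ε < 1 / 4) :
    Real.exp (-(ε + 3 * ε ^ 2)) ≤ 2 - Real.exp ε := by
  have e1 : Real.exp ε ≤ 1 + ε + ε ^ 2 := by
    have := Real.abs_exp_sub_one_sub_id_le (x := ε) (by rw [abs_le]; constructor <;> linarith)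
    have := (abs_le.1 this).2
    linarith
  have e2 := Real.quadratic_le_exp_of_nonneg (x := ε + 3 * ε ^ 2) (by positivity)
  have e3 : 1 + ε + 3 * ε ^ 2 + ε ^ 2 / 2 ≤ Real.exp (ε + 3 * ε ^ 2) := by
    nlinarith [pow_pos h0 3, pow_pos h0 4]
  have e4 : 0 < 1 - ε - ε ^ 2 := by nlinarith
  have e5 : 1 ≤ (1 - ε - ε ^ 2) * Real.exp (ε + 3 * ε ^ 2) := by
    refine le_trans ?_ (mul_le_mul_of_nonneg_left e3 e4.le)
    have : 0 ≤ ε ^ 2 * (3 / 2 - 9 / 2 * ε - 7 / 2 * ε ^ 2) := by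
      apply mul_nonneg (by positivity); nlinarith
    nlinarith
  have e6 : Real.exp (-(ε + 3 * ε ^ 2)) ≤ 1 - ε - ε ^ 2 := by
    rw [Real.exp_neg, inv_le_iff_one_le_mul₀ (Real.exp_pos _)]
    exact e5
  linarith

lemma aux_tel (N : ℕ) (F : ℕ → ℝ) (k : ℕ) (hk : k ≤ N) :
    ∑ j ∈ Finset.univ.filter (fun j : Fin N => j.1 < k), (F (j.1 + 1) - F j.1) = F k - F 0 := by
  induction k with
  | zero => simp
  | succ k ih =>
    have : Finset.univ.filter (fun j : Fin N => j.1 < k + 1) =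
        insert ⟨k, hk⟩ (Finset.univ.filter (fun j : Fin N => j.1 < k)) := by
      ext j
      simp only [Finset.mem_filter, Finset.mem_univ, true_and, Finset.mem_insert, Fin.ext_iff]
      omega
    rw [this, Finset.sum_insert (by simp), ih (by omega)]
    ring

lemma aux_card (N : ℕ) (P : Fin N → Prop) [DecidablePred P]
    (h : ∀ i j : Fin N, i ≤ j → P j → P i) (j : Fin N) :
    j.1 < (Finset.univ.filter P).card ↔ P j := by
  constructor
  · intro hj
    by_contra hP
    have : Finset.univ.filter P ⊆ Finset.Iio j := by
      intro i hi
      simp only [Finset.mem_filter, Finset.mem_univ, true_and] at hi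
      rw [Finset.mem_Iio]
      by_contra hh
      exact hP (h j i (not_lt.1 hh) hi)
    have := Finset.card_le_card this
    rw [Fin.card_Iio] at this
    omega
  · intro hP
    have : Finset.Iic j ⊆ Finset.univ.filter P := by
      intro i hi
      simp only [Finset.mem_filter, Finset.mem_univ, true_and]
      exact h i j (Finset.mem_Iic.1 hi) hP
    have := Finset.card_le_card this
    rw [Fin.card_Iic] at this
    omega

/-- (Dual convergence in a late phase.)  For an instance with an exact
block solver, `λ* = 1`, `δ ∈ (0,1]`, `0 < ε < δ²/4` and `T ≥ (log m)/ε²`, any run of the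
core algorithm has a phase `T' ≥ (1−δ)T` whose dual value satisfies `Θ_{T'} ≥ 1 − δ`. -/
theorem stmt_16 (m : ℕ) (hm : 2 ≤ m)
    (𝒞 : Type) [Fintype 𝒞] [Nonempty 𝒞] [DecidableEq 𝒞]
    (X : 𝒞 → Set (Fin m → ℝ))
    (hXne : ∀ c, (X c).Nonempty) (hXcl : ∀ c, IsClosed (X c))
    (hXcv : ∀ c, Convex ℝ (X c))
    (hXpos : ∀ c, ∀ x ∈ X c, ∀ r, 0 ≤ x r)
    (𝒳 : Set (Fin m → ℝ))
    (h𝒳 : 𝒳 = {x | ∃ g : 𝒞 → Fin m → ℝ, (∀ c, g c ∈ X c) ∧ x = ∑ c, g c})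
    (lam : ℝ) (hlam : lam = ⨅ x : 𝒳, ‖(x : Fin m → ℝ)‖) (hlam1 : lam = 1)
    -- an exact block solver (σ = 1)
    (f : 𝒞 → (Fin m → ℝ) → (Fin m → ℝ))
    (hfmem : ∀ c y, (∀ r, 0 ≤ y r) → f c y ∈ X c)
    (hfapx : ∀ c y, (∀ r, 0 ≤ y r) →
      ∑ r, y r * f c y r ≤ ⨅ x : X c, ∑ r, y r * (x : Fin m → ℝ) r)
    (δ : ℝ) (hδ0 : 0 < δ) (hδ1 : δ ≤ 1)
    (ε : ℝ) (hε : 0 < ε) (hεδ : ε < δ ^ 2 / 4)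
    -- a run of the core algorithm with parameters ε and T
    (T : ℕ) (hT1 : 1 ≤ T) (hTlarge : Real.log m / ε ^ 2 ≤ (T : ℝ))
    (N : ℕ) (p : Fin N → ℕ) (Cu : Fin N → 𝒞) (ξ : Fin N → ℝ)
    (hp : ∀ j, 1 ≤ p j ∧ p j ≤ T)
    (hpmono : ∀ j k : Fin N, j ≤ k → p j ≤ p k)
    (hξ0 : ∀ j, 0 ≤ ξ j)
    (w : ℕ → Fin m → ℝ) (hw0 : w 0 = fun _ => 1)
    (b : Fin N → Fin m → ℝ) (hb : ∀ j, b j = f (Cu j) (w j.1))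
    (hwsucc : ∀ j : Fin N, w (j.1 + 1) = fun r => w j.1 r * Real.exp (ε * ξ j * b j r))
    (hstep : ∀ j, ξ j * ‖b j‖ ≤ 1)
    (hphase : ∀ t, 1 ≤ t → t ≤ T → ∀ c,
      ∑ j ∈ Finset.univ.filter (fun j => p j = t ∧ Cu j = c), ξ j = 1)
    (y : ℕ → Fin m → ℝ)
    (hy : ∀ t, y t = w (Finset.univ.filter (fun j : Fin N => p j ≤ t)).card)
    (Θ : ℕ → ℝ)
    (hΘ : ∀ t, Θ t = (∑ c, ⨅ x : X c, ∑ r, y t r * (x : Fin m → ℝ) r) / ∑ r, |y t r|) :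
    ∃ T', 1 ≤ T' ∧ T' ≤ T ∧ (1 - δ) * T ≤ (T' : ℝ) ∧ 1 - δ ≤ Θ T' := by
  have hm0 : 0 < m := by omega
  have hε4 : ε < 1 / 4 := by nlinarith
  have hTpos : (0 : ℝ) < T := by exact_mod_cast hT1
  -- positivity of prices
  have hwpos : ∀ k, k ≤ N → ∀ r, 0 < w k r := by
    intro k
    induction k with
    | zero => intro _ r; rw [hw0]; exact one_pos
    | succ k ih =>
      intro hk r
      rw [hwsucc ⟨k, hk⟩]
      exact mul_pos (ih (by omega) r) (Real.exp_pos _)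
  have hbX : ∀ j, b j ∈ X (Cu j) := by
    intro j
    rw [hb]
    exact hfmem _ _ fun r => (hwpos _ j.2.le r).le
  have hb0 : ∀ j r, 0 ≤ b j r := fun j r => hXpos _ _ (hbX j) r
  have hlog : ∀ k, k ≤ N → ∀ r, Real.log (w k r) =
      ∑ j ∈ Finset.univ.filter (fun j : Fin N => j.1 < k), ε * ξ j * b j r := by
    intro k hk r
    have h := aux_tel N (fun k => Real.log (w k r)) k hk
    simp only [hw0, Real.log_one, sub_zero] at h
    rw [← h]
    refine Finset.sum_congr rfl fun j _ => ?_
    rw [hwsucc j, Real.log_mul (hwpos _ j.2.le r).ne' (Real.exp_pos _).ne', Real.log_exp]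
    ring
  have hwmono : ∀ k l, k ≤ l → l ≤ N → ∀ r, w k r ≤ w l r := by
    intro k l hkl hl r
    rw [← Real.log_le_log_iff (hwpos k (hkl.trans hl) r) (hwpos l hl r),
      hlog k (hkl.trans hl), hlog l hl]
    refine Finset.sum_le_sum_of_subset_of_nonneg ?_ ?_
    · intro j hj
      simp only [Finset.mem_filter, Finset.mem_univ, true_and] at hj ⊢
      omega
    · intro j _ _
      exact mul_nonneg (mul_nonneg hε.le (hξ0 j)) (hb0 j r)
  have hncard : ∀ t, (Finset.univ.filter (fun j : Fin N => p j ≤ t)).card ≤ N := by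
    intro t
    exact (Finset.card_le_univ _).trans (by simp)
  have hnt : ∀ t (j : Fin N),
      j.1 < (Finset.univ.filter (fun j : Fin N => p j ≤ t)).card ↔ p j ≤ t := by
    intro t j
    exact aux_card N (fun j => p j ≤ t) (fun i j hij h => (hpmono i j hij).trans h) j
  have hypos : ∀ t r, 0 < y t r := by
    intro t r
    rw [hy]
    exact hwpos _ (hncard t) r
  -- the block optimum
  set opt : 𝒞 → (Fin m → ℝ) → ℝ := fun c v => ⨅ x : X c, ∑ r, v r * (x : Fin m → ℝ) r with hopt
  have hbdd : ∀ c (v : Fin m → ℝ), (∀ r, 0 ≤ v r) →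
      BddBelow (Set.range fun x : X c => ∑ r, v r * (x : Fin m → ℝ) r) := by
    intro c v hv
    refine ⟨0, ?_⟩
    rintro _ ⟨x, rfl⟩
    exact Finset.sum_nonneg fun r _ => mul_nonneg (hv r) (hXpos c _ x.2 r)
  have hoptmono : ∀ c (u v : Fin m → ℝ), (∀ r, 0 ≤ u r) → (∀ r, u r ≤ v r) →
      opt c u ≤ opt c v := by
    intro c u v hu huv
    refine ciInf_mono (hbdd c u hu) fun x => ?_
    exact Finset.sum_le_sum fun r _ => mul_le_mul_of_nonneg_right (huv r) (hXpos c _ x.2 r)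
  have hoptle : ∀ c (v : Fin m → ℝ), (∀ r, 0 ≤ v r) → ∀ x ∈ X c,
      opt c v ≤ ∑ r, v r * x r := by
    intro c v hv x hx
    exact ciInf_le (hbdd c v hv) ⟨x, hx⟩
  have hopt0 : ∀ c (v : Fin m → ℝ), (∀ r, 0 ≤ v r) → 0 ≤ opt c v := by
    intro c v hv
    have := (hXne c).to_subtype
    exact le_ciInf fun x => Finset.sum_nonneg fun r _ => mul_nonneg (hv r) (hXpos c _ x.2 r)
  set S : ℕ → ℝ := fun t => ∑ r, y t r with hS
  have hSpos : ∀ t, 0 < S t := by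
    intro t
    have : Nonempty (Fin m) := ⟨⟨0, hm0⟩⟩
    exact Finset.sum_pos (fun r _ => hypos t r) Finset.univ_nonempty
  have hΘ' : ∀ t, Θ t = (∑ c, opt c (y t)) / S t := by
    intro t
    rw [hΘ]
    congr 1
    exact Finset.sum_congr rfl fun r _ => abs_of_pos (hypos t r)
  have hΘ0 : ∀ t, 0 ≤ Θ t := by
    intro t
    rw [hΘ']
    exact div_nonneg (Finset.sum_nonneg fun c _ => hopt0 c _ fun r => (hypos t r).le) (hSpos t).le
  -- weak duality
  have hlam' : (⨅ x : 𝒳, ‖(x : Fin m → ℝ)‖) = 1 := by rw [← hlam, hlam1]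
  have hΘ1 : ∀ t, Θ t ≤ 1 := by
    intro t
    rw [← hlam']
    have : Nonempty 𝒳 := by
      choose g hg using hXne
      exact ⟨⟨∑ c, g c, by rw [h𝒳]; exact ⟨g, hg, rfl⟩⟩⟩
    refine le_ciInf fun x => ?_
    obtain ⟨x, hx⟩ := x
    rw [h𝒳] at hx
    obtain ⟨g, hg, rfl⟩ := hx
    rw [hΘ', div_le_iff₀ (hSpos t)]
    calc ∑ c, opt c (y t) ≤ ∑ c, ∑ r, y t r * g c r :=
          Finset.sum_le_sum fun c _ => hoptle c _ (fun r => (hypos t r).le) _ (hg c)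
      _ = ∑ r, y t r * (∑ c, g c) r := by
          rw [Finset.sum_comm]
          refine Finset.sum_congr rfl fun r _ => ?_
          rw [Finset.sum_apply, Finset.mul_sum]
      _ ≤ ∑ r, y t r * ‖∑ c, g c‖ := by
          refine Finset.sum_le_sum fun r _ => mul_le_mul_of_nonneg_left ?_ (hypos t r).le
          exact (le_abs_self _).trans (norm_le_pi_norm (∑ c, g c) r)
      _ = ‖∑ c, g c‖ * S t := by rw [← Finset.sum_mul, mul_comm]
  -- one step
  have hη0 : 0 ≤ Real.exp ε - 1 := by linarith [Real.add_one_le_exp ε]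
  have hone : ∀ j : Fin N, (∑ r, w (j.1 + 1) r) - ∑ r, w j.1 r ≤
      (Real.exp ε - 1) * (ξ j * opt (Cu j) (y (p j))) := by
    intro j
    have hwj : ∀ r, 0 ≤ w j.1 r := fun r => (hwpos _ j.2.le r).le
    have h1 : (∑ r, w (j.1 + 1) r) - ∑ r, w j.1 r ≤
        (Real.exp ε - 1) * (ξ j * ∑ r, w j.1 r * b j r) := by
      rw [← Finset.sum_sub_distrib, Finset.mul_sum, Finset.mul_sum]
      refine Finset.sum_le_sum fun r _ => ?_
      rw [hwsucc j]
      have h2 := aux_exp_s16 ε (ξ j * b j r) (mul_nonneg (hξ0 j) (hb0 j r))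
        (le_trans (mul_le_mul_of_nonneg_left
          ((le_abs_self _).trans (norm_le_pi_norm (b j) r)) (hξ0 j)) (hstep j))
      have h3 := mul_le_mul_of_nonneg_left h2 (hwj r)
      rw [← mul_assoc] at h3
      simp only [← mul_assoc] at h3 ⊢
      linarith
    refine h1.trans (mul_le_mul_of_nonneg_left (mul_le_mul_of_nonneg_left ?_ (hξ0 j)) hη0)
    have h4 : ∑ r, w j.1 r * b j r ≤ opt (Cu j) (w j.1) := by
      rw [hb]
      exact hfapx _ _ hwj
    refine h4.trans (hoptmono _ _ _ hwj fun r => ?_)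
    rw [hy]
    exact hwmono _ _ ((hnt (p j) j).2 le_rfl).le (hncard _) r
  have hStel : ∀ t, S t = (∑ r, w 0 r) + ∑ j ∈ Finset.univ.filter (fun j : Fin N => p j ≤ t),
      ((∑ r, w (j.1 + 1) r) - ∑ r, w j.1 r) := by
    intro t
    have h := aux_tel N (fun k => ∑ r, w k r) _ (hncard t)
    simp only [hnt] at h
    rw [h]
    simp only [hS, hy]
    ring
  have hphaseS : ∀ t, 1 ≤ t → t ≤ T → S t - S (t - 1) ≤ (Real.exp ε - 1) * (Θ t * S t) := by
    intro t ht1 htT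
    have hsplit : Finset.univ.filter (fun j : Fin N => p j ≤ t) =
        Finset.univ.filter (fun j : Fin N => p j ≤ t - 1) ∪
        Finset.univ.filter (fun j : Fin N => p j = t) := by
      ext j
      simp only [Finset.mem_filter, Finset.mem_univ, true_and, Finset.mem_union]
      omega
    have hdisj : Disjoint (Finset.univ.filter (fun j : Fin N => p j ≤ t - 1))
        (Finset.univ.filter (fun j : Fin N => p j = t)) := by
      rw [Finset.disjoint_left]
      intro j
      simp only [Finset.mem_filter, Finset.mem_univ, true_and]
      omega
    have e1 := hStel t
    rw [hsplit, Finset.sum_union hdisj] at e1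
    have e2 := hStel (t - 1)
    have h1 : ∑ j ∈ Finset.univ.filter (fun j : Fin N => p j = t),
        ((∑ r, w (j.1 + 1) r) - ∑ r, w j.1 r) ≤
        ∑ j ∈ Finset.univ.filter (fun j : Fin N => p j = t),
          (Real.exp ε - 1) * (ξ j * opt (Cu j) (y t)) := by
      refine Finset.sum_le_sum fun j hj => ?_
      have hj' : p j = t := (Finset.mem_filter.1 hj).2
      have := hone j
      rwa [hj'] at this
    have h2 : ∑ j ∈ Finset.univ.filter (fun j : Fin N => p j = t), ξ j * opt (Cu j) (y t) =
        ∑ c, opt c (y t) := by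
      rw [← Finset.sum_fiberwise (Finset.univ.filter (fun j : Fin N => p j = t)) Cu]
      refine Finset.sum_congr rfl fun c _ => ?_
      rw [Finset.filter_filter]
      calc _ = ∑ j ∈ Finset.univ.filter (fun j => p j = t ∧ Cu j = c), ξ j * opt c (y t) := by
            refine Finset.sum_congr rfl fun j hj => ?_
            rw [(Finset.mem_filter.1 hj).2.2]
        _ = _ := by rw [← Finset.sum_mul, hphase t ht1 htT c, one_mul]
    rw [← Finset.mul_sum, h2] at h1
    have h3 : Θ t * S t = ∑ c, opt c (y t) := by
      rw [hΘ', div_mul_cancel₀ _ (hSpos t).ne']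
    rw [h3]
    linarith
  -- multiplicative growth
  set c := ε + 3 * ε ^ 2 with hc
  have hc0 : 0 ≤ c := by positivity
  have hgrow : ∀ t, 1 ≤ t → t ≤ T → S t ≤ S (t - 1) * Real.exp (c * Θ t) := by
    intro t ht1 htT
    have h1 := hphaseS t ht1 htT
    have h2 := aux_exp_s16 (-c) (Θ t) (hΘ0 t) (hΘ1 t)
    have h3 := mul_le_mul_of_nonneg_left (aux_c ε hε hε4) (hΘ0 t)
    rw [← hc] at h3
    have h4 : Real.exp (-c * Θ t) ≤ 1 - (Real.exp ε - 1) * Θ t := by linarith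
    have h5 := mul_le_mul_of_nonneg_left h4 (hSpos t).le
    have h6 : S t * Real.exp (-c * Θ t) ≤ S (t - 1) := by linarith
    have h7 := mul_le_mul_of_nonneg_right h6 (Real.exp_pos (c * Θ t)).le
    rw [mul_assoc, ← Real.exp_add] at h7
    simpa using h7
  have hS0 : S 0 = m := by
    have : Finset.univ.filter (fun j : Fin N => p j ≤ 0) = ∅ := by
      ext j
      have := (hp j).1
      simp only [Finset.mem_filter, Finset.mem_univ, true_and, Finset.notMem_empty, iff_false]
      omega
    simp only [hS, hy, this, Finset.card_empty, hw0]
    simp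
  have hSbound : ∀ t, t ≤ T → S t ≤ m * Real.exp (c * ∑ s ∈ Finset.range t, Θ (s + 1)) := by
    intro t
    induction t with
    | zero => intro _; simp [hS0]
    | succ t ih =>
      intro ht
      have h1 := hgrow (t + 1) (by omega) ht
      rw [Nat.add_sub_cancel] at h1
      refine h1.trans ?_
      rw [Finset.sum_range_succ, mul_add, Real.exp_add, ← mul_assoc]
      exact mul_le_mul_of_nonneg_right (ih (by omega)) (Real.exp_pos _).le
  -- primal lower bound
  have hprimal : Real.exp (ε * T) ≤ S T := by
    set z : Fin m → ℝ := ∑ c, ∑ j ∈ Finset.univ.filter (fun j => Cu j = c), (ξ j / T) • b j with hz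
    have hz𝒳 : z ∈ 𝒳 := by
      rw [h𝒳]
      refine ⟨_, fun c => ?_, rfl⟩
      refine (hXcv c).sum_mem (fun j _ => div_nonneg (hξ0 j) hTpos.le) ?_ ?_
      · rw [← Finset.sum_div, div_eq_one_iff_eq hTpos.ne']
        rw [← Finset.sum_fiberwise_of_maps_to (t := Finset.Icc 1 T) (g := p)
          (fun j _ => Finset.mem_Icc.2 (hp j))]
        rw [Finset.sum_congr rfl (g := fun _ => (1 : ℝ))]
        · simp
        · intro t ht
          rw [Finset.mem_Icc] at ht
          rw [← hphase t ht.1 ht.2 c, Finset.filter_filter]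
          refine Finset.sum_congr ?_ fun _ _ => rfl
          ext j
          simp [and_comm]
      · intro j hj
        have := hbX j
        rwa [(Finset.mem_filter.1 hj).2] at this
    have hz' : z = ∑ j, (ξ j / T) • b j := Finset.sum_fiberwise _ _ _
    have hznorm : 1 ≤ ‖z‖ := by
      rw [← hlam']
      refine ciInf_le (f := fun x : 𝒳 => ‖(x : Fin m → ℝ)‖) ⟨0, ?_⟩ ⟨z, hz𝒳⟩
      rintro _ ⟨x, rfl⟩
      exact norm_nonneg _
    have hz0 : ∀ r, 0 ≤ z r := by
      intro r
      rw [hz', Finset.sum_apply]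
      exact Finset.sum_nonneg fun j _ => mul_nonneg (div_nonneg (hξ0 j) hTpos.le) (hb0 j r)
    have hr : ∃ r, 1 ≤ z r := by
      by_contra! hcon
      have : ‖z‖ < 1 := by
        rw [pi_norm_lt_iff one_pos]
        intro r
        rw [Real.norm_eq_abs, abs_of_nonneg (hz0 r)]
        exact hcon r
      linarith
    obtain ⟨r, hr⟩ := hr
    have hlogy : Real.log (y T r) = ε * T * z r := by
      rw [hy, hlog _ (hncard T), hz', Finset.sum_apply, Finset.mul_sum]
      rw [Finset.filter_true_of_mem fun j _ => (hnt T j).2 (hp j).2]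
      refine Finset.sum_congr rfl fun j _ => ?_
      simp only [Pi.smul_apply, smul_eq_mul]
      field_simp
    calc Real.exp (ε * T) ≤ Real.exp (ε * T * z r) := by
          apply Real.exp_le_exp.2
          nlinarith [mul_pos hε hTpos]
      _ = y T r := by rw [← hlogy, Real.exp_log (hypos T r)]
      _ ≤ S T := Finset.single_le_sum (f := fun r => y T r)
          (fun r _ => (hypos T r).le) (Finset.mem_univ r)
  -- conclusion
  by_contra! hcon
  have hΘsum : ∑ s ∈ Finset.range T, Θ (s + 1) ≤ (1 - δ ^ 2) * T := by
    have h1 : ∀ s ∈ Finset.range T, Θ (s + 1) ≤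
        (1 - δ) + if ((s + 1 : ℕ) : ℝ) < (1 - δ) * T then δ else 0 := by
      intro s hs
      rw [Finset.mem_range] at hs
      split_ifs with h
      · linarith [hΘ1 (s + 1)]
      · have := hcon (s + 1) (by omega) (by omega) (not_lt.1 h)
        linarith
    refine (Finset.sum_le_sum h1).trans ?_
    rw [Finset.sum_add_distrib, ← Finset.sum_filter, Finset.sum_const, Finset.sum_const,
      Finset.card_range, nsmul_eq_mul, nsmul_eq_mul]
    have h2 : ((Finset.range T).filter
        (fun s => ((s + 1 : ℕ) : ℝ) < (1 - δ) * T)).card ≤ ⌊(1 - δ) * T⌋₊ := by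
      have : (Finset.range T).filter (fun s => ((s + 1 : ℕ) : ℝ) < (1 - δ) * T) ⊆
          Finset.range ⌊(1 - δ) * T⌋₊ := by
        intro s hs
        have := (Finset.mem_filter.1 hs).2
        rw [Finset.mem_range]
        have := Nat.le_floor this.le
        omega
      simpa using Finset.card_le_card this
    have h3 : (((Finset.range T).filter
        (fun s => ((s + 1 : ℕ) : ℝ) < (1 - δ) * T)).card : ℝ) ≤ (1 - δ) * T :=
      le_trans (by exact_mod_cast h2)
        (Nat.floor_le (mul_nonneg (by linarith) hTpos.le))
    have := mul_le_mul_of_nonneg_right h3 hδ0.le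
    nlinarith
  have hmexp : (m : ℝ) ≤ Real.exp (ε ^ 2 * T) := by
    rw [← Real.log_le_iff_le_exp (by exact_mod_cast hm0)]
    rw [div_le_iff₀ (by positivity)] at hTlarge
    linarith
  have hfin : Real.exp (ε * T) ≤ Real.exp (ε ^ 2 * T + c * ((1 - δ ^ 2) * T)) := by
    rw [Real.exp_add]
    refine (hprimal.trans (hSbound T le_rfl)).trans ?_
    refine mul_le_mul hmexp ?_ (Real.exp_pos _).le (Real.exp_pos _).le
    exact Real.exp_le_exp.2 (mul_le_mul_of_nonneg_left hΘsum hc0)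
  rw [Real.exp_le_exp] at hfin
  have h1 : ε ≤ ε ^ 2 + c * (1 - δ ^ 2) := by
    refine le_of_mul_le_mul_right ?_ hTpos
    linarith
  have h2 : c * (1 - δ ^ 2) ≤ c * (1 - 4 * ε) :=
    mul_le_mul_of_nonneg_left (by linarith) hc0
  have h3 : 0 < ε ^ 3 := pow_pos hε 3
  rw [hc] at h2
  rw [hc] at h1
  nlinarith
end
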